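/- There is no connected simple graph G on exactly 9 vertices having two longest paths P and Q with V(P) ≠ V(Q) and |V(P) ∩ V(Q)| = 7 such that the subgraph of G induced on V(G) \ (V(P) ∩ V(Q)) is connected. Equivalently, for every connected simple graph G on 9 vertices, if P and Q are longest paths with V(P) ≠ V(Q) and |V(P) ∩ V(Q)| = 7, then V(P) ∩ V(Q) is a separator of G. -/

import Mathlib

open SimpleGraph

/-- `P` is a longest path in the simple graph `G`: it is a path, and every path in `G`
has length at most the length of `P`. -/
def IsLongestPath {V : Type*} (G : SimpleGraph V) {u v : V} (P : G.Walk u v) : Prop :=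
  P.IsPath ∧ ∀ {a b : V} (Q : G.Walk a b), Q.IsPath → Q.length ≤ P.length

/-! ### Paths as lists of vertices -/

/-- A duplicate-free list of consecutively adjacent vertices is no longer than the vertex list of
a longest path. -/
theorem IsLongestPath.length_le {V : Type*} {G : SimpleGraph V} {u v : V} {P : G.Walk u v}
    (hP : IsLongestPath G P) {l : List V} (hl : l.Nodup) (hc : l.IsChain G.Adj) :
    l.length ≤ P.length + 1 := by
  rcases eq_or_ne l [] with rfl | hne
  · simp
  · have h := hP.2 (Walk.ofSupport l hne hc)
      ((Walk.isPath_def _).2 (by rwa [Walk.support_ofSupport]))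
    rw [Walk.length_ofSupport] at h
    omega

/-! ### A search for Hamiltonian paths on the vertices `0, …, 8`

A graph on `{0, …, 8}` is stored as the number whose bit `9 * i + j` tells whether `i` and `j` are
adjacent. -/

/-- Insert the edge `xy` into the graph `E`. -/
def addEdge (E x y : ℕ) : ℕ := E ||| (1 <<< (9 * x + y)) ||| (1 <<< (9 * y + x))

/-- Does `E` have a path that starts in `x` and then runs through the vertices in the list? The
first argument bounds the length of the list. -/
def hasPathFrom (E : ℕ) : ℕ → ℕ → List ℕ → Bool
  | _, _, [] => true
  | 0, _, _ :: _ => false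
  | n + 1, x, z :: r =>
    (z :: r).any fun y => E.testBit (9 * x + y) && hasPathFrom E n y ((z :: r).erase y)

/-- Does `E` have a Hamiltonian path that starts in `0` or `7`? The match on `E` makes the kernel
evaluate `E` only once. -/
def hasHamPath : ℕ → Bool
  | 0 => false
  | E + 1 => hasPathFrom (E + 1) 8 0 [1, 2, 3, 4, 5, 6, 7, 8] ||
      hasPathFrom (E + 1) 8 7 [0, 1, 2, 3, 4, 5, 6, 8]

/-- Does adding to `E` a path from `y` through all vertices of the list always produce a
Hamiltonian path? -/
def forcedByOne : ℕ → ℕ → ℕ → List ℕ → Bool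
  | 0, E, _, _ => hasHamPath E
  | n + 1, E, y, s => hasHamPath E ||
      (!s.isEmpty && s.all fun z => forcedByOne n (addEdge E y z) z (s.erase z))

/-- Does adding to `E` two disjoint paths, from `x` and from `y`, which together run through all
vertices of the list always produce a Hamiltonian path? -/
def forcedByTwo : ℕ → ℕ → ℕ → ℕ → List ℕ → Bool
  | 0, E, _, _, _ => hasHamPath E
  | n + 1, E, x, y, s => hasHamPath E ||
      ((s.all fun z => forcedByTwo n (addEdge E x z) z y (s.erase z)) &&
        forcedByOne (n + 1) E y s)

/-- The path `0, 1, …, 7` together with the edge `p8`. -/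
def pathWithPendant (p : ℕ) : ℕ :=
  addEdge ((List.range 7).foldl (fun E i => addEdge E i (i + 1)) 0) p 8

/-- Does adding to `pathWithPendant p` a path with vertex set `{0, …, 8} \ {p}` and with interior
vertex `8` always produce a Hamiltonian path? -/
def forcedAt (p : ℕ) : Bool :=
  ((List.range 8).erase p).all fun i => ((List.range 8).erase p).all fun j =>
    Nat.ble j i || forcedByTwo 5 (addEdge (addEdge (pathWithPendant p) 8 i) 8 j) i j
      ((((List.range 8).erase p).erase i).erase j)

theorem forcedAt_of_lt_four : (List.range 4).all forcedAt = true := by decide +kernel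

/-- All edges of the graph `E` are edges of the relation `H`. -/
def EdgesIn (H : ℕ → ℕ → Prop) (E : ℕ) : Prop :=
  ∀ i < 9, ∀ j < 9, E.testBit (9 * i + j) = true → H i j

theorem EdgesIn.addEdge {H : ℕ → ℕ → Prop} (hH : ∀ i j, H i j → H j i) {E x y : ℕ}
    (hE : EdgesIn H E) (hx : x < 9) (hy : y < 9) (hxy : H x y) : EdgesIn H (addEdge E x y) := by
  intro i hi j hj h
  simp only [_root_.addEdge, Nat.testBit_or, Nat.one_shiftLeft, Nat.testBit_two_pow,
    Bool.or_eq_true, decide_eq_true_eq] at h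
  rcases h with (h | h) | h
  · exact hE i hi j hj h
  · obtain ⟨rfl, rfl⟩ : x = i ∧ y = j := by omega
    exact hxy
  · obtain ⟨rfl, rfl⟩ : x = j ∧ y = i := by omega
    exact hH _ _ hxy

theorem exists_isChain_of_hasPathFrom {H : ℕ → ℕ → Prop} {E : ℕ} (hE : EdgesIn H E) :
    ∀ (n x : ℕ) (s : List ℕ), x < 9 → (∀ y ∈ s, y < 9) → hasPathFrom E n x s = true →
      ∃ m : List ℕ, m.Perm s ∧ (x :: m).IsChain H
  | _, x, [], _, _, _ => ⟨[], .refl _, .singleton x⟩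
  | 0, _, _ :: _, _, _, h => by simp [hasPathFrom] at h
  | n + 1, x, z :: r, hx, hs, h => by
    rw [hasPathFrom, List.any_eq_true] at h
    obtain ⟨y, hy, h⟩ := h
    rw [Bool.and_eq_true] at h
    obtain ⟨m, hm, hc⟩ := exists_isChain_of_hasPathFrom hE n y _ (hs y hy)
      (fun w hw => hs w (List.mem_of_mem_erase hw)) h.2
    exact ⟨y :: m, (hm.cons y).trans (List.perm_cons_erase hy).symm,
      .cons_cons (hE x hx y (hs y hy) h.1) hc⟩

/-- The relation `H` has a Hamiltonian path on `{0, …, 8}`. -/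
def HamPath (H : ℕ → ℕ → Prop) : Prop := ∃ m : List ℕ, m.Perm (List.range 9) ∧ m.IsChain H

theorem HamPath.of_hasHamPath {H : ℕ → ℕ → Prop} {E : ℕ} (hE : EdgesIn H E)
    (h : hasHamPath E = true) : HamPath H := by
  cases E with
  | zero => simp [hasHamPath] at h
  | succ E =>
    rw [hasHamPath, Bool.or_eq_true] at h
    rcases h with h | h
    · obtain ⟨m, hm, hc⟩ := exists_isChain_of_hasPathFrom hE _ _ _ (by decide) (by decide) h
      exact ⟨_, (hm.cons 0).trans (by decide), hc⟩
    · obtain ⟨m, hm, hc⟩ := exists_isChain_of_hasPathFrom hE _ _ _ (by decide) (by decide) h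
      exact ⟨_, (hm.cons 7).trans (by decide), hc⟩

theorem HamPath.of_forcedByOne {H : ℕ → ℕ → Prop} (hH : ∀ i j, H i j → H j i) :
    ∀ (n E y : ℕ) (s d : List ℕ), EdgesIn H E → y < 9 → (∀ w ∈ s, w < 9) →
      forcedByOne n E y s = true → d.Perm s → (y :: d).IsChain H → HamPath H
  | 0, _, _, _, _, hE, _, _, h, _, _ => .of_hasHamPath hE h
  | n + 1, E, y, s, d, hE, hy, hs, h, hd, hc => by
    rw [forcedByOne, Bool.or_eq_true] at h
    rcases h with h | h
    · exact .of_hasHamPath hE h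
    rw [Bool.and_eq_true, List.all_eq_true] at h
    cases d with
    | nil => simp [hd.symm.eq_nil] at h
    | cons z d =>
      have hz : z ∈ s := hd.subset List.mem_cons_self
      rw [List.isChain_cons_cons] at hc
      exact of_forcedByOne hH n _ z _ d (hE.addEdge hH hy (hs z hz) hc.1) (hs z hz)
        (fun w hw => hs w (List.mem_of_mem_erase hw)) (h.2 z hz)
        (List.cons_perm_iff_perm_erase.1 hd).2 hc.2

theorem HamPath.of_forcedByTwo {H : ℕ → ℕ → Prop} (hH : ∀ i j, H i j → H j i) :
    ∀ (n E x y : ℕ) (s c d : List ℕ), EdgesIn H E → x < 9 → y < 9 → (∀ w ∈ s, w < 9) →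
      forcedByTwo n E x y s = true → (c ++ d).Perm s → (x :: c).IsChain H → (y :: d).IsChain H →
      HamPath H
  | 0, _, _, _, _, _, _, hE, _, _, _, h, _, _, _ => .of_hasHamPath hE h
  | n + 1, E, x, y, s, c, d, hE, hx, hy, hs, h, hp, hc, hd => by
    rw [forcedByTwo, Bool.or_eq_true] at h
    rcases h with h | h
    · exact .of_hasHamPath hE h
    rw [Bool.and_eq_true, List.all_eq_true] at h
    cases c with
    | nil => exact .of_forcedByOne hH _ E y s d hE hy hs h.2 hp hd
    | cons z c =>
      have hz : z ∈ s := hp.subset List.mem_cons_self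
      rw [List.isChain_cons_cons] at hc
      exact of_forcedByTwo hH n _ z y _ c d (hE.addEdge hH hx (hs z hz) hc.1) (hs z hz) hy
        (fun w hw => hs w (List.mem_of_mem_erase hw)) (h.1 z hz)
        (List.cons_perm_iff_perm_erase.1 hp).2 hc.2 hd

theorem EdgesIn.pathWithPendant {H : ℕ → ℕ → Prop} (hH : ∀ i j, H i j → H j i) {p : ℕ}
    (hp : p < 8) (hpath : ∀ i < 7, H i (i + 1)) (hp8 : H p 8) :
    EdgesIn H (pathWithPendant p) := by
  have key : ∀ n ≤ 7, EdgesIn H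
      ((List.range n).foldl (fun E i => _root_.addEdge E i (i + 1)) 0) := by
    intro n
    induction n with
    | zero => intro _ i _ j _ h; simp at h
    | succ n ih =>
      intro hn
      rw [List.range_succ, List.foldl_append]
      exact (ih (by omega)).addEdge hH (by omega) (by omega) (hpath n (by omega))
  exact (key 7 le_rfl).addEdge hH (by omega) (by omega) hp8

/-- If `H` contains the path `0, 1, …, 7`, the edge `p8`, and a path with vertex set
`{0, …, 8} \ {p}` and with interior vertex `8`, then `H` has a Hamiltonian path. -/
theorem HamPath.of_two_paths {H : ℕ → ℕ → Prop} (hH : ∀ i j, H i j → H j i) {p : ℕ}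
    (hp : p < 4) (hpath : ∀ i < 7, H i (i + 1)) (hp8 : H p 8) {i j : ℕ} {c d : List ℕ}
    (hperm : (i :: c ++ j :: d).Perm ((List.range 8).erase p))
    (hc : (8 :: i :: c).IsChain H) (hd : (8 :: j :: d).IsChain H) : HamPath H := by
  wlog hij : i < j generalizing i j c d
  · refine this (List.perm_append_comm.trans hperm) hd hc ?_
    have hnd : (i :: c ++ j :: d).Nodup := hperm.nodup_iff.2 (List.nodup_range.erase p)
    have : i ≠ j := by
      rintro rfl
      simp at hnd
    omega
  have h := List.all_eq_true.1 forcedAt_of_lt_four p (List.mem_range.2 hp)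
  rw [forcedAt, List.all_eq_true] at h
  have hi : i ∈ (List.range 8).erase p := hperm.subset (by simp)
  have hj : j ∈ (List.range 8).erase p := hperm.subset (by simp)
  have hlt : ∀ w ∈ (List.range 8).erase p, w < 9 := fun w hw => by
    have := List.mem_range.1 (List.mem_of_mem_erase hw)
    omega
  have h := List.all_eq_true.1 (h i hi) j hj
  rw [Bool.or_eq_true, Nat.ble_eq] at h
  rw [List.isChain_cons_cons] at hc hd
  refine .of_forcedByTwo hH 5 _ i j _ c d
    (((EdgesIn.pathWithPendant hH (by omega) hpath hp8).addEdge hH (by omega)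
      (hlt i hi) hc.1).addEdge hH (by omega) (hlt j hj) hd.1) (hlt i hi) (hlt j hj)
    (fun w hw => hlt w (List.mem_of_mem_erase (List.mem_of_mem_erase hw)))
    (h.resolve_left (by omega)) ?_ hc.2 hd.2
  have h₁ : (i :: j :: (c ++ d)).Perm ((List.range 8).erase p) :=
    (List.perm_middle.symm.cons i).trans hperm
  exact (List.cons_perm_iff_perm_erase.1 (List.cons_perm_iff_perm_erase.1 h₁).2).2

/-! ### Two paths with eight vertices -/

theorem List.Nodup.mem_cons_of_length {V : Type*} [Fintype V] {k : List V} {z : V} (hk : k.Nodup)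
    (hlen : k.length + 1 = Fintype.card V) (hz : z ∉ k) (x : V) : x ∈ z :: k := by
  classical
  have h := List.toFinset_card_of_nodup (List.nodup_cons.2 ⟨hz, hk⟩)
  rw [← List.mem_toFinset, (Finset.card_eq_iff_eq_univ _).1 (h.trans hlen)]
  exact Finset.mem_univ x

theorem SimpleGraph.isChain_adj_reverse {V : Type*} {G : SimpleGraph V} {l : List V}
    (h : l.IsChain G.Adj) : l.reverse.IsChain G.Adj :=
  List.isChain_reverse.2 (h.imp fun _ _ => Adj.symm)

/-- Let `l` and `m` be the vertex lists of paths on `V \ {q}` and on `V \ {p}`, where `p` and `q`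
are adjacent and `V` has nine elements. Then there is a Hamiltonian path. -/
theorem exists_hamiltonian_list {V : Type*} [Fintype V] (G : SimpleGraph V)
    (hcard : Fintype.card V = 9) {p q : V} (hpq : G.Adj p q) {l m : List V}
    (hl : l.Nodup) (hlc : l.IsChain G.Adj) (hll : l.length = 8) (hql : q ∉ l)
    (hm : m.Nodup) (hmc : m.IsChain G.Adj) (hml : m.length = 8) (hpm : p ∉ m) :
    ∃ k : List V, k.Nodup ∧ k.IsChain G.Adj ∧ k.length = 9 := by
  classical
  have hVl : ∀ x, x ∈ q :: l := hl.mem_cons_of_length (by omega) hql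
  have hVm : ∀ x, x ∈ p :: m := hm.mem_cons_of_length (by omega) hpm
  have hpl : p ∈ l := (List.mem_cons.1 (hVl p)).resolve_left hpq.ne
  wlog hp4 : l.idxOf p < 4 generalizing l
  · refine this (l := l.reverse) (by simpa) (isChain_adj_reverse hlc) (by simpa) (by simpa)
      (fun x => by simpa using hVl x) (by simpa) ?_
    · have h1 : l.idxOf p < l.length := List.idxOf_lt_length_iff.2 hpl
      have h2 : l.reverse[7 - l.idxOf p]'(by simp; omega) = p := by
        rw [List.getElem_reverse]
        simp only [hll, show 8 - 1 - (7 - l.idxOf p) = l.idxOf p by omega]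
        exact List.getElem_idxOf h1
      have h3 := (List.nodup_reverse.2 hl).idxOf_getElem (7 - l.idxOf p) (by simp; omega)
      rw [h2] at h3
      omega
  have hqm : q ∈ m := (List.mem_cons.1 (hVm q)).resolve_left hpq.ne'
  obtain ⟨C, D, rfl⟩ := List.append_of_mem hqm
  -- If `q` is an end of `m`, prepend or append `p`.
  rcases C.eq_nil_or_concat' with rfl | ⟨C, i, rfl⟩
  · exact ⟨p :: q :: D, List.nodup_cons.2 ⟨hpm, hm⟩, .cons_cons hpq hmc, by simpa using hml⟩
  rcases D with _ | ⟨j, D⟩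
  · refine ⟨p :: (C ++ [i] ++ [q]).reverse,
      List.nodup_cons.2 ⟨by rwa [List.mem_reverse], List.nodup_reverse.2 hm⟩, ?_,
      by simpa using hml⟩
    have h := isChain_adj_reverse hmc
    rw [List.reverse_concat] at h ⊢
    exact .cons_cons hpq h
  -- Number the vertices of `l` by `0, …, 7` in their order and `q` by `8`.
  have hlq : (l ++ [q]).Nodup := List.nodup_append_comm.1 (List.nodup_cons.2 ⟨hql, hl⟩)
  have hmem : ∀ x, x ∈ l ++ [q] := fun x => by simpa [or_comm] using hVl x
  set f : ℕ → V := fun a => (l ++ [q]).getD a q with hf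
  set g : V → ℕ := fun x => (l ++ [q]).idxOf x with hg
  have hlen : (l ++ [q]).length = 9 := by simp [hll]
  have hfg : ∀ x, f (g x) = x := fun x => by
    have := List.idxOf_lt_length_iff.2 (hmem x)
    simp only [hf, hg]
    rw [List.getD_eq_getElem _ _ this, List.getElem_idxOf]
  have hgf : ∀ a < 9, g (f a) = a := fun a ha => by
    simp only [hf, hg]
    rw [List.getD_eq_getElem _ _ (by omega), hlq.idxOf_getElem]
  have hg9 : ∀ x, g x < 9 := fun x => hlen ▸ List.idxOf_lt_length_iff.2 (hmem x)
  have hginj : Function.Injective g := Function.LeftInverse.injective hfg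
  have hgq : g q = 8 := by
    simp only [hg]
    rw [List.idxOf_append_of_notMem hql]
    simp [hll]
  have hgp : g p = l.idxOf p := List.idxOf_append_of_mem hpl
  have hmap : ∀ k : List V, k.IsChain G.Adj →
      (k.map g).IsChain fun a b => G.Adj (f a) (f b) := fun k hk => by
    rw [List.isChain_map]
    simpa only [hfg] using hk
  have hmc' := List.isChain_split.1 hmc
  obtain ⟨k, hk, hkc⟩ := HamPath.of_two_paths (H := fun a b => G.Adj (f a) (f b))
    (fun _ _ h => h.symm) (p := g p) (hgp ▸ hp4)
    (by
      intro a ha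
      have := List.isChain_iff_getElem.1 hlc a (by omega)
      simp only [hf]
      rw [List.getD_eq_getElem _ _ (by omega), List.getD_eq_getElem _ _ (by omega),
        List.getElem_append_left (by omega), List.getElem_append_left (by omega)]
      exact this)
    (by
      rw [← hgq]
      simpa only [hfg] using hpq)
    (i := g i) (j := g j) (c := C.reverse.map g) (d := D.map g)
    (by
      have hperm : (q :: (i :: C.reverse ++ j :: D)).Perm (C ++ [i] ++ q :: j :: D) := by
        rw [← List.reverse_concat]
        exact (((List.reverse_perm _).append_right _).cons q).trans List.perm_middle.symm
      have hnd := List.nodup_cons.1 (hperm.nodup_iff.2 hm)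
      have hsub : ∀ x ∈ i :: C.reverse ++ j :: D, g x ∈ (List.range 8).erase (g p) := by
        intro x hx
        rw [List.nodup_range.mem_erase_iff, List.mem_range]
        have hxp : x ≠ p := by
          rintro rfl
          exact hpm (hperm.subset (List.mem_cons_of_mem _ hx))
        have hxq : g x ≠ 8 := fun h => hnd.1 (hginj (h.trans hgq.symm) ▸ hx)
        have := hg9 x
        exact ⟨hginj.ne hxp, by omega⟩
      have hlen' := hperm.length_eq
      rw [hml, List.length_cons] at hlen'
      have h : ((i :: C.reverse ++ j :: D).map g).Perm ((List.range 8).erase (g p)) :=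
        ((hnd.2.map hginj).subperm fun a ha => by
          obtain ⟨x, hx, rfl⟩ := List.mem_map.1 ha
          exact hsub x hx).perm_of_length_le (by
            rw [List.length_erase_of_mem (List.mem_range.2 (by omega)), List.length_map,
              List.length_range]
            omega)
      simpa using h)
    (by
      have := hmap (q :: i :: C.reverse) (by
        simpa using isChain_adj_reverse hmc'.1)
      simpa [hgq] using this)
    (by simpa [hgq] using hmap _ hmc'.2)
  refine ⟨k.map f, ?_, ?_, ?_⟩
  · refine (List.nodup_map_iff_inj_on (hk.nodup_iff.2 List.nodup_range)).2 fun a ha b hb hab => ?_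
    have ha := List.mem_range.1 (hk.subset ha)
    have hb := List.mem_range.1 (hk.subset hb)
    rw [← hgf a ha, hab, hgf b hb]
  · rwa [List.isChain_map]
  · simpa using hk.length_eq

/-- for every connected simple graph `G` on 9 vertices, if `P` and `Q`
are longest paths with `V(P) ≠ V(Q)` and `|V(P) ∩ V(Q)| = 7`, then `V(P) ∩ V(Q)` is a
separator of `G`, i.e. the subgraph induced on its complement is not connected. -/
theorem statement4 {V : Type*} [Fintype V] (G : SimpleGraph V)
    (hG : G.Connected) (hcard : Fintype.card V = 9)
    {u₁ v₁ u₂ v₂ : V} (P : G.Walk u₁ v₁) (Q : G.Walk u₂ v₂)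
    (hP : IsLongestPath G P) (hQ : IsLongestPath G Q)
    (hne : {x | x ∈ P.support} ≠ {x | x ∈ Q.support})
    (hint : ({x | x ∈ P.support} ∩ {x | x ∈ Q.support}).ncard = 7) :
    ¬ (G.induce ({x | x ∈ P.support} ∩ {x | x ∈ Q.support})ᶜ).Connected := by
  classical
  intro hcon
  have hlen : P.length = Q.length := le_antisymm (hQ.2 P hP.1) (hP.2 Q hQ.1)
  have hPn := hP.1.support_nodup
  have hQn := hQ.1.support_nodup
  have hPl := P.length_support
  have hQl := Q.length_support
  have hPc := List.toFinset_card_of_nodup hPn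
  have hQc := List.toFinset_card_of_nodup hQn
  have hPQ : (P.support.toFinset ∩ Q.support.toFinset).card = 7 := by
    rw [← hint, ← Set.ncard_coe_finset]
    congr 1
    ext x
    simp
  have hle := Finset.card_le_card
    (Finset.inter_subset_left : P.support.toFinset ∩ Q.support.toFinset ⊆ _)
  have hle' := Finset.card_le_univ (P.support.toFinset ∪ Q.support.toFinset)
  have hun := Finset.card_union_add_card_inter P.support.toFinset Q.support.toFinset
  have h7 : P.length ≠ 6 := by
    intro h
    apply hne
    have h₁ := Finset.eq_of_subset_of_card_le
      (Finset.inter_subset_left : P.support.toFinset ∩ Q.support.toFinset ⊆ _) (by omega)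
    have h₂ := Finset.eq_of_subset_of_card_le
      (Finset.inter_subset_right : P.support.toFinset ∩ Q.support.toFinset ⊆ _) (by omega)
    have h₃ := h₁.symm.trans h₂
    ext x
    simpa using Finset.ext_iff.1 h₃ x
  have hP8 : P.support.length = 8 := by omega
  have hQ8 : Q.support.length = 8 := by omega
  obtain ⟨q, -, hq⟩ := Finset.exists_mem_notMem_of_card_lt_card
    (s := P.support.toFinset) (t := Finset.univ) (by rw [Finset.card_univ]; omega)
  obtain ⟨p, -, hp⟩ := Finset.exists_mem_notMem_of_card_lt_card
    (s := Q.support.toFinset) (t := Finset.univ) (by rw [Finset.card_univ]; omega)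
  have hne' : p ≠ q := by
    rintro rfl
    have := Finset.card_lt_univ_of_notMem (s := P.support.toFinset ∪ Q.support.toFinset) (x := p)
      (by simp_all)
    omega
  rw [List.mem_toFinset] at hp hq
  have hpq : G.Adj p q := by
    obtain ⟨w⟩ := hcon.preconnected ⟨p, fun h => hp h.2⟩ ⟨q, fun h => hq h.1⟩
    cases w with
    | nil => exact absurd rfl hne'
    | @cons _ r _ hadj _ =>
      have hadj : G.Adj p r := hadj
      have hr : (r : V) = q := by
        by_contra hrq
        exact r.2 ⟨(List.mem_cons.1 (hPn.mem_cons_of_length (by omega) hq r)).resolve_left hrq,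
          (List.mem_cons.1 (hQn.mem_cons_of_length (by omega) hp r)).resolve_left hadj.ne'⟩
      rwa [hr] at hadj
  obtain ⟨k, hk, hkc, hk9⟩ := exists_hamiltonian_list G hcard hpq hPn P.isChain_adj_support hP8 hq
    hQn Q.isChain_adj_support hQ8 hp
  have := hP.length_le hk hkc
  omega
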